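/- arXiv:1806.01924 — 7 statements merged into one kernel-verified Lean document; each statement's English description precedes it below -/
import Mathlib

section
/- Regard P_i as a function of a single real variable t by setting γ_{uj} := t simultaneously for all j = 1,…,K (so γ_j = t + γ_{dj}), with all other parameters fixed. Then as t → +∞, P_i converges to δ_{hi}/r (Proposition 6.1, first bullet). -/
open BigOperators Finset Filter Topology

/-- A map of the form `t ↦ (1 + (t + g + r) / b) * m - 1` with `b, m > 0` tends to infinity. -/
lemma tendsto_one_add_div_mul_sub_one_atTop {b m : ℝ} (g r : ℝ) (hb : 0 < b) (hm : 0 < m) :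
    Tendsto (fun t : ℝ => (1 + (t + g + r) / b) * m - 1) atTop atTop := by
  refine tendsto_atTop_add_const_right _ _ (Tendsto.atTop_mul_const hm ?_)
  refine tendsto_atTop_add_const_left _ _ (Tendsto.atTop_div_const hb ?_)
  exact tendsto_atTop_add_const_right _ _ (tendsto_atTop_add_const_right _ _ tendsto_id)

/-- If `u * y - 1` tends to infinity, then `(u * x - 1) / (u * y - 1)` tends to `x / y`. -/
lemma tendsto_mul_sub_one_div_mul_sub_one {α : Type*} {l : Filter α} {u : α → ℝ} {x y : ℝ}
    (hy : 0 < y) (hu : Tendsto (fun t => u t * y - 1) l atTop) :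
    Tendsto (fun t => (u t * x - 1) / (u t * y - 1)) l (𝓝 (x / y)) := by
  have h : Tendsto (fun t => x / y + (x / y - 1) * (u t * y - 1)⁻¹) l (𝓝 (x / y)) := by
    simpa using ((tendsto_inv_atTop_zero.comp hu).const_mul (x / y - 1)).const_add (x / y)
  refine h.congr' ?_
  filter_upwards [hu.eventually_gt_atTop 0] with t ht
  have ht' := ht.ne'
  rw [eq_div_iff ht', add_mul, mul_assoc, inv_mul_cancel₀ ht']
  field_simp
  ring

/-- Proposition 6.1, first bullet: setting `γ_{uj} := t` simultaneously for all `j`,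
the price `P_i` converges to `δ_{hi}/r` as `t → +∞`. -/
theorem stmt_9
    (K : ℕ) (hK : 1 ≤ K) (r q : ℝ) (hr : 0 < r) (hq0 : 0 < q) (hq1 : q < 1)
    (dh dd gd gtu gtd lam mul muh : Fin K → ℝ)
    (hdh : ∀ i, dd i < dh i) (hdd : ∀ i, 0 < dd i)
    (hgd : ∀ i, 0 < gd i)
    (hgtu : ∀ i, 0 < gtu i) (hgtd : ∀ i, 0 < gtd i)
    (hlam : ∀ i, 0 < lam i) (hmul : ∀ i, 0 < mul i) (hmuh : ∀ i, 0 < muh i)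
    (a d : Fin K → ℝ) (ha : ∀ i, a i = lam i * mul i) (hd : ∀ i, d i = lam i * muh i)
    (i : Fin K)
    (Psi : ℝ → Fin K → ℝ)
    (hPsi : ∀ t j, Psi t j =
      (1 + (t + gd j + r) / (q * d j)) * (1 + gtd j / ((1 - q) * a j)) - 1)
    (Gamma : ℝ → Fin K → ℝ)
    (hGamma : ∀ t j, Gamma t j =
      (1 + (t + gd j + r) / (q * d j)) * (1 + (gtd j + r) / ((1 - q) * a j)) - 1)
    (Lam : ℝ → Fin K → ℝ) (hLam : ∀ t j, Lam t j = Psi t j / Gamma t j)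
    (Omeg : ℝ → Fin K → ℝ) (hOmeg : ∀ t j, Omeg t j = dd j / (q * d j * Gamma t j))
    (Theta : ℝ → ℝ)
    (hTheta : ∀ t, Theta t =
      (∑ j, gtu j * Omeg t j) / (r + ∑ j, gtu j * (1 - Lam t j)))
    (P : ℝ → ℝ)
    (hP : ∀ t, P t =
      (gd i / ((1 - q) * a i * Gamma t i) - Lam t i) * Theta t + dh i / r
        - q * Omeg t i * (1 + (1 - r + gd i / q) * (1 + gtd i / ((1 - q) * a i)))) :
    Tendsto P atTop (𝓝 (dh i / r)) := by
  have hb j : 0 < q * d j := by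
    rw [hd]; exact mul_pos hq0 (mul_pos (hlam j) (hmuh j))
  have hc j : 0 < (1 - q) * a j := by
    rw [ha]; exact mul_pos (sub_pos.2 hq1) (mul_pos (hlam j) (hmul j))
  have hy j : 0 < 1 + (gtd j + r) / ((1 - q) * a j) := by
    have := div_pos (add_pos (hgtd j) hr) (hc j)
    linarith
  have hG j := tendsto_one_add_div_mul_sub_one_atTop (gd j) r (hb j) (hy j)
  have hL j : Tendsto (fun t => Lam t j) atTop
      (𝓝 ((1 + gtd j / ((1 - q) * a j)) / (1 + (gtd j + r) / ((1 - q) * a j)))) := by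
    simp only [hLam, hPsi, hGamma]
    exact tendsto_mul_sub_one_div_mul_sub_one (hy j) (hG j)
  have hG' j : Tendsto (fun t => Gamma t j) atTop atTop := by
    simpa only [hGamma] using hG j
  have hO j : Tendsto (fun t => Omeg t j) atTop (𝓝 0) := by
    simp only [hOmeg]
    exact ((hG' j).const_mul_atTop (hb j)).const_div_atTop (dd j)
  have hpos : 0 < r + ∑ j, gtu j *
      (1 - (1 + gtd j / ((1 - q) * a j)) / (1 + (gtd j + r) / ((1 - q) * a j))) := by
    refine add_pos_of_pos_of_nonneg hr (Finset.sum_nonneg fun j _ => ?_)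
    refine mul_nonneg (hgtu j).le (sub_nonneg.2 ((div_le_one (hy j)).2 ?_))
    have := div_le_div_of_nonneg_right (show gtd j ≤ gtd j + r by linarith) (hc j).le
    linarith
  have hT : Tendsto Theta atTop (𝓝 0) := by
    rw [funext hTheta]
    have hnum : Tendsto (fun t => ∑ j, gtu j * Omeg t j) atTop (𝓝 0) := by
      simpa using tendsto_finsetSum univ fun j _ => (hO j).const_mul (gtu j)
    have hden := (tendsto_finsetSum univ fun j _ =>
      ((hL j).const_sub 1).const_mul (gtu j)).const_add r
    exact zero_div (r + _) ▸ hnum.div hden hpos.ne'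
  have hF : Tendsto (fun t => gd i / ((1 - q) * a i * Gamma t i)) atTop (𝓝 0) :=
    ((hG' i).const_mul_atTop (hc i)).const_div_atTop (gd i)
  rw [funext hP]
  simpa using ((((hF.sub (hL i)).mul hT).add_const (dh i / r)).sub
    (((hO i).const_mul q).mul_const
      (1 + (1 - r + gd i / q) * (1 + gtd i / ((1 - q) * a i)))))
end

section
/- Regard P_i as a function of a single real variable t by setting γ_{dj} := t simultaneously for all j = 1,…,K (so γ_j = γ_{uj} + t), with all other parameters fixed. Then as t → +∞, P_i converges to δ_{hi}/r − δ_{di}·((1−q) a_i + γ̃_{di}) / ((1−q) a_i + γ̃_{di} + r) (Proposition 6.1, second bullet). -/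
open BigOperators Finset Filter Topology

lemma tendsto_affine_div_affine_atTop (p b c e : ℝ) (hc : c ≠ 0) :
    Tendsto (fun t : ℝ => (p * t + b) / (c * t + e)) atTop (𝓝 (p / c)) := by
  have inv_lim (x y : ℝ) : Tendsto (fun t : ℝ => x + y * t⁻¹) atTop (𝓝 x) := by
    simpa using (tendsto_inv_atTop_zero.const_mul y).const_add x
  refine ((inv_lim p b).div (inv_lim c e) hc).congr' ?_
  filter_upwards [eventually_ne_atTop 0] with t ht
  have h (x y : ℝ) : x + y * t⁻¹ = (x * t + y) / t := by field_simp
  simp only [Pi.div_apply, h]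
  exact div_div_div_cancel_right₀ ht _ _

/-- Proposition 6.1, second bullet: setting `γ_{dj} := t` simultaneously for all `j`,
the price `P_i` converges to
`δ_{hi}/r − δ_{di}((1−q)a_i + γ̃_{di})/((1−q)a_i + γ̃_{di} + r)` as `t → +∞`. -/
theorem stmt_10
    (K : ℕ) (hK : 1 ≤ K) (r q : ℝ) (hr : 0 < r) (hq0 : 0 < q) (hq1 : q < 1)
    (dh dd gu gtu gtd lam mul muh : Fin K → ℝ)
    (hdh : ∀ i, dd i < dh i) (hdd : ∀ i, 0 < dd i)
    (hgu : ∀ i, 0 < gu i)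
    (hgtu : ∀ i, 0 < gtu i) (hgtd : ∀ i, 0 < gtd i)
    (hlam : ∀ i, 0 < lam i) (hmul : ∀ i, 0 < mul i) (hmuh : ∀ i, 0 < muh i)
    (a d : Fin K → ℝ) (ha : ∀ i, a i = lam i * mul i) (hd : ∀ i, d i = lam i * muh i)
    (i : Fin K)
    (Psi : ℝ → Fin K → ℝ)
    (hPsi : ∀ t j, Psi t j =
      (1 + (gu j + t + r) / (q * d j)) * (1 + gtd j / ((1 - q) * a j)) - 1)
    (Gamma : ℝ → Fin K → ℝ)
    (hGamma : ∀ t j, Gamma t j =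
      (1 + (gu j + t + r) / (q * d j)) * (1 + (gtd j + r) / ((1 - q) * a j)) - 1)
    (Lam : ℝ → Fin K → ℝ) (hLam : ∀ t j, Lam t j = Psi t j / Gamma t j)
    (Omeg : ℝ → Fin K → ℝ) (hOmeg : ∀ t j, Omeg t j = dd j / (q * d j * Gamma t j))
    (Theta : ℝ → ℝ)
    (hTheta : ∀ t, Theta t =
      (∑ j, gtu j * Omeg t j) / (r + ∑ j, gtu j * (1 - Lam t j)))
    (P : ℝ → ℝ)
    (hP : ∀ t, P t =
      (t / ((1 - q) * a i * Gamma t i) - Lam t i) * Theta t + dh i / r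
        - q * Omeg t i * (1 + (1 - r + t / q) * (1 + gtd i / ((1 - q) * a i)))) :
    Tendsto P atTop
      (𝓝 (dh i / r - dd i * ((1 - q) * a i + gtd i) / ((1 - q) * a i + gtd i + r))) := by
  have hA (j) : 0 < (1 - q) * a j := by
    rw [ha]
    exact mul_pos (by linarith) (mul_pos (hlam j) (hmul j))
  have hD (j) : 0 < q * d j := by
    rw [hd]
    exact mul_pos hq0 (mul_pos (hlam j) (hmuh j))
  obtain ⟨A, hAdef⟩ : ∃ A : Fin K → ℝ, ∀ j, (1 - q) * a j = A j := ⟨_, fun _ => rfl⟩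
  obtain ⟨D, hDdef⟩ : ∃ D : Fin K → ℝ, ∀ j, q * d j = D j := ⟨_, fun _ => rfl⟩
  simp only [hAdef, hDdef] at hA hD hPsi hGamma hOmeg hP ⊢
  have hS (j) : 0 < A j + gtd j + r := by linarith [hA j, hgtd j]
  have aff (x : ℝ) (j) (t : ℝ) : (1 + (gu j + t + r) / D j) * (1 + x / A j) - 1 =
      (1 + x / A j) / D j * t + ((1 + (gu j + r) / D j) * (1 + x / A j) - 1) := by
    ring
  have hc (j) : (1 + (gtd j + r) / A j) / D j ≠ 0 := by
    have := hA j
    have := hD j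
    have := hgtd j
    positivity
  have hquot (p b : ℝ) (j) : Tendsto (fun t => (p * t + b) / Gamma t j) atTop
      (𝓝 (p / ((1 + (gtd j + r) / A j) / D j))) := by
    simp only [hGamma, aff]
    exact tendsto_affine_div_affine_atTop p b _ _ (hc j)
  have hLlim (j) : Tendsto (fun t => Lam t j) atTop
      (𝓝 ((A j + gtd j) / (A j + gtd j + r))) := by
    simp only [hLam, hPsi, aff]
    convert hquot _ _ j using 2
    have := (hA j).ne'
    have := (hD j).ne'
    have := (hS j).ne'
    have : A j + (gtd j + r) ≠ 0 := by rwa [← add_assoc]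
    field_simp
    ring
  have hOlim (j) : Tendsto (fun t => Omeg t j) atTop (𝓝 0) := by
    simp only [hOmeg]
    simpa [div_div] using hquot 0 (dd j / D j) j
  have hpos : 0 < r + ∑ j, gtu j * (1 - (A j + gtd j) / (A j + gtd j + r)) := by
    refine add_pos_of_pos_of_nonneg hr (sum_nonneg fun j _ => ?_)
    refine mul_nonneg (hgtu j).le (sub_nonneg.2 ?_)
    rw [div_le_one (hS j)]
    linarith
  have hTlim : Tendsto Theta atTop (𝓝 0) := by
    have hnum : Tendsto (fun t => ∑ j, gtu j * Omeg t j) atTop (𝓝 0) := by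
      simpa using tendsto_finsetSum univ fun j _ => (hOlim j).const_mul (gtu j)
    have hden := (tendsto_finsetSum univ fun j _ =>
      ((hLlim j).const_sub 1).const_mul (gtu j)).const_add r
    rw [funext hTheta]
    rw [← zero_div]
    exact hnum.div hden hpos.ne'
  have hcoef : Tendsto (fun t => t / (A i * Gamma t i)) atTop
      (𝓝 ((A i)⁻¹ / ((1 + (gtd i + r) / A i) / D i))) := by
    refine (hquot (A i)⁻¹ 0 i).congr fun t => ?_
    rw [add_zero, ← div_eq_inv_mul, div_div]
  have hlast := hquot (dd i / D i * (1 + gtd i / A i))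
    (q * (dd i / D i) * (1 + (1 - r) * (1 + gtd i / A i))) i
  have hmain := (((hcoef.sub (hLlim i)).mul hTlim).add_const (dh i / r)).sub hlast
  rw [funext hP]
  convert hmain using 2
  · rw [hOmeg, ← div_div]
    congr 1
    field_simp
    ring
  · have := (hA i).ne'
    have := (hD i).ne'
    have := (hS i).ne'
    have : A i + (gtd i + r) ≠ 0 := by rwa [← add_assoc]
    field_simp
    ring
end

section
/- Regard Θ as a function of (γ̃_{u1},…,γ̃_{uK}) with all other parameters fixed (note that Ω(j) and Λ(j) do not depend on the γ̃_{uj}). (a) For any positive reals c_1,…,c_K, setting γ̃_{uj} := c_j t for all j, Θ converges as t → +∞ to (Σ_{j=1}^K c_j Ω(j)) / (Σ_{j=1}^K c_j (1 − Λ(j))), a limit that depends on the direction (c_1,…,c_K). (b) Consequently, if K ≥ 2 and there exist indices j, k with Ω(j)·(1 − Λ(k)) ≠ Ω(k)·(1 − Λ(j)), then there is no real number L such that Θ tends to L as every γ̃_{uj} tends to +∞ (i.e., along the product of the atTop filters in the K coordinates); hence, whenever in addition γ_{di}/((1−q) a_i Γ(i)) ≠ Λ(i), the limit of the price P_i as all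 γ̃_{uj} → ∞ does not exist (Proposition 6.1, third bullet, as established in its proof). -/
open BigOperators Finset Filter Topology

/-- A ratio of weighted sums with a constant `r` added to the denominator converges, along the ray
in direction `c`, to the ratio without that constant. -/
theorem tendsto_ray_sum_div_add_sum {ι : Type*} [Fintype ι] (r : ℝ) (o w c : ι → ℝ)
    (hB : ∑ j, c j * w j ≠ 0) :
    Tendsto (fun t : ℝ => (∑ j, c j * t * o j) / (r + ∑ j, c j * t * w j)) atTop
      (𝓝 ((∑ j, c j * o j) / ∑ j, c j * w j)) := by
  have hden : Tendsto (fun t : ℝ => r / t + ∑ j, c j * w j) atTop (𝓝 (∑ j, c j * w j)) := by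
    simpa using (tendsto_const_nhds.div_atTop tendsto_id).add_const (∑ j, c j * w j)
  refine (tendsto_const_nhds.div hden hB).congr' ?_
  filter_upwards [eventually_gt_atTop 0] with t ht
  have hpull (f : ι → ℝ) : ∑ j, c j * t * f j = t * ∑ j, c j * f j := by
    rw [Finset.mul_sum]
    exact Finset.sum_congr rfl fun j _ => by ring
  simp only [Pi.div_apply]
  rw [hpull, hpull, ← mul_div_mul_left _ (r / t + _) ht.ne', mul_add, mul_div_cancel₀ _ ht.ne']

/-- Rays with positive direction tend to infinity in every coordinate. -/
theorem tendsto_ray_pi_atTop {ι : Type*} (c : ι → ℝ) (hc : ∀ j, 0 < c j) :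
    Tendsto (fun t : ℝ => fun j => c j * t) atTop (Filter.pi fun _ : ι => (atTop : Filter ℝ)) :=
  tendsto_pi.2 fun j => tendsto_id.const_mul_atTop (hc j)

/-- A linear form vanishing at every positive vector is zero. -/
theorem eq_zero_of_forall_pos_sum_mul_eq_zero {ι : Type*} [Fintype ι] (v : ι → ℝ)
    (h : ∀ c : ι → ℝ, (∀ j, 0 < c j) → ∑ j, c j * v j = 0) (k : ι) : v k = 0 := by
  classical
  have h1 := h (fun _ => 1) fun _ => one_pos
  have h2 := h (fun j => 1 + if j = k then 1 else 0) fun j => by positivity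
  simp only [add_mul, Finset.sum_add_distrib, h1] at h2
  simpa using h2

/-- Proposition 6.1, third bullet (as established in its proof). Regard `Θ` and
`P_i` as functions of the vector `(γ̃_{u1}, …, γ̃_{uK})`.
(a) Along every direction `(c_1,…,c_K)` of positive weights, setting
`γ̃_{uj} := c_j t`, `Θ` converges as `t → +∞` to
`(Σ_j c_j Ω(j)) / (Σ_j c_j (1 − Λ(j)))`.
(b) If `K ≥ 2` and two directions give different limits (i.e. there are `j, k`
with `Ω(j)(1 − Λ(k)) ≠ Ω(k)(1 − Λ(j))`), then `Θ` has no limit along the product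
of the `atTop` filters in the `K` coordinates; hence if moreover
`γ_{di}/((1−q) a_i Γ(i)) ≠ Λ(i)`, the price `P_i` has no limit either. -/
theorem stmt_11
    (K : ℕ) (hK : 1 ≤ K) (r q : ℝ) (hr : 0 < r) (hq0 : 0 < q) (hq1 : q < 1)
    (dh dd gu gd gtd lam mul muh : Fin K → ℝ)
    (hdh : ∀ i, dd i < dh i) (hdd : ∀ i, 0 < dd i)
    (hgu : ∀ i, 0 < gu i) (hgd : ∀ i, 0 < gd i) (hgtd : ∀ i, 0 < gtd i)
    (hlam : ∀ i, 0 < lam i) (hmul : ∀ i, 0 < mul i) (hmuh : ∀ i, 0 < muh i)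
    (a d : Fin K → ℝ) (ha : ∀ i, a i = lam i * mul i) (hd : ∀ i, d i = lam i * muh i)
    (i : Fin K)
    (Psi : Fin K → ℝ)
    (hPsi : ∀ j, Psi j =
      (1 + (gu j + gd j + r) / (q * d j)) * (1 + gtd j / ((1 - q) * a j)) - 1)
    (Gamma : Fin K → ℝ)
    (hGamma : ∀ j, Gamma j =
      (1 + (gu j + gd j + r) / (q * d j)) * (1 + (gtd j + r) / ((1 - q) * a j)) - 1)
    (Lam : Fin K → ℝ) (hLam : ∀ j, Lam j = Psi j / Gamma j)
    (Omeg : Fin K → ℝ) (hOmeg : ∀ j, Omeg j = dd j / (q * d j * Gamma j))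
    (Theta : (Fin K → ℝ) → ℝ)
    (hTheta : ∀ g : Fin K → ℝ, Theta g =
      (∑ j, g j * Omeg j) / (r + ∑ j, g j * (1 - Lam j)))
    (P : (Fin K → ℝ) → ℝ)
    (hP : ∀ g : Fin K → ℝ, P g =
      (gd i / ((1 - q) * a i * Gamma i) - Lam i) * Theta g + dh i / r
        - q * Omeg i * (1 + (1 - r + gd i / q) * (1 + gtd i / ((1 - q) * a i)))) :
    (∀ c : Fin K → ℝ, (∀ j, 0 < c j) →
      Tendsto (fun t : ℝ => Theta (fun j => c j * t)) atTop
        (𝓝 ((∑ j, c j * Omeg j) / (∑ j, c j * (1 - Lam j))))) ∧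
    (2 ≤ K → (∃ j k : Fin K, Omeg j * (1 - Lam k) ≠ Omeg k * (1 - Lam j)) →
      (¬ ∃ L : ℝ, Tendsto Theta (Filter.pi fun _ : Fin K => (atTop : Filter ℝ)) (𝓝 L)) ∧
      (gd i / ((1 - q) * a i * Gamma i) ≠ Lam i →
        ¬ ∃ L : ℝ, Tendsto P (Filter.pi fun _ : Fin K => (atTop : Filter ℝ)) (𝓝 L))) := by
  have hw : ∀ j, 0 < 1 - Lam j := by
    intro j
    have hqd : 0 < q * d j := by
      rw [hd]
      exact mul_pos hq0 (mul_pos (hlam j) (hmuh j))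
    have hqa : 0 < (1 - q) * a j := by
      rw [ha]
      exact mul_pos (sub_pos.2 hq1) (mul_pos (hlam j) (hmul j))
    have hx : 0 < (gu j + gd j + r) / (q * d j) :=
      div_pos (add_pos (add_pos (hgu j) (hgd j)) hr) hqd
    have hy : 0 < gtd j / ((1 - q) * a j) := div_pos (hgtd j) hqa
    have hz : 0 < r / ((1 - q) * a j) := div_pos hr hqa
    have hlt : Psi j < Gamma j := by
      rw [hPsi, hGamma, add_div (gtd j)]
      nlinarith [mul_pos hx hz]
    have hpos : 0 < Psi j := by
      rw [hPsi]
      nlinarith [mul_pos hx hy]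
    rw [hLam, sub_pos, div_lt_one (hpos.trans hlt)]
    exact hlt
  have hB : ∀ c : Fin K → ℝ, (∀ j, 0 < c j) → ∑ j, c j * (1 - Lam j) ≠ 0 := fun c hc =>
    (Finset.sum_pos (fun j _ => mul_pos (hc j) (hw j)) ⟨i, Finset.mem_univ i⟩).ne'
  have hray : ∀ c : Fin K → ℝ, (∀ j, 0 < c j) →
      Tendsto (fun t : ℝ => Theta (fun j => c j * t)) atTop
        (𝓝 ((∑ j, c j * Omeg j) / (∑ j, c j * (1 - Lam j)))) := by
    intro c hc
    simp only [hTheta]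
    exact tendsto_ray_sum_div_add_sum r Omeg (fun j => 1 - Lam j) c (hB c hc)
  refine ⟨hray, fun _ ⟨j, k, hjk⟩ => ?_⟩
  have hno : ¬ ∃ L : ℝ, Tendsto Theta (Filter.pi fun _ : Fin K => (atTop : Filter ℝ)) (𝓝 L) := by
    rintro ⟨L, hL⟩
    have hzero := eq_zero_of_forall_pos_sum_mul_eq_zero
      (fun j => Omeg j - L * (1 - Lam j)) fun c hc => by
        have hlim := tendsto_nhds_unique (hray c hc) (hL.comp (tendsto_ray_pi_atTop c hc))
        rw [div_eq_iff (hB c hc), Finset.mul_sum, ← sub_eq_zero, ← Finset.sum_sub_distrib] at hlim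
        rw [← hlim]
        exact Finset.sum_congr rfl fun j _ => by ring
    exact hjk (by linear_combination (1 - Lam k) * hzero j - (1 - Lam j) * hzero k)
  refine ⟨hno, fun hne ⟨L, hL⟩ => hno ?_⟩
  have hcoef := sub_ne_zero.2 hne
  refine ⟨_, (((hL.add_const (q * Omeg i * (1 + (1 - r + gd i / q) *
    (1 + gtd i / ((1 - q) * a i))))).sub_const (dh i / r)).div_const
      (gd i / ((1 - q) * a i * Gamma i) - Lam i)).congr fun g => ?_⟩
  rw [div_eq_iff hcoef, hP]
  ring
end

section
/- Regard P_i as a function of a single real variable t by setting λ_j := t simultaneously for all j = 1,…,K (so a_j = t μ_{lj} and d_j = t μ_{hj}), with all other parameters fixed. Define Λ̂(j) := ((1−q)(γ_j+r)μ_{lj} + q γ̃_{dj} μ_{hj}) / ((1−q)(γ_j+r)μ_{lj} + q(γ̃_{dj}+r)μ_{hj}), Ω̂(j) := δ_{dj} / ((γ_j+r) + (q/(1−q))(μ_{hj}/μ_{lj})(γ̃_{dj}+r)), and Ĝ(i) := q γ_{di} μ_{hi} / ((1−q)(γ_i+r)μ_{li} + q(γ̃_{di}+r)μ_{hi}). Then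 as t → +∞, P_i converges to (Ĝ(i) − Λ̂(i))·(Σ_{j=1}^K γ̃_{uj} Ω̂(j)) / (r + Σ_{j=1}^K γ̃_{uj}(1 − Λ̂(j))) + δ_{hi}/r − q Ω̂(i)·(2 − r + γ_{di}/q) (Proposition 6.1, fourth bullet). -/
open BigOperators Finset Filter Topology

/-- The first-order coefficient at infinity of `(1 + x / (p t m)) (1 + y / (s t l)) - 1`. -/
theorem tendsto_mul_one_add_div_mul_one_add_div_sub_one {p s m l : ℝ} (x y : ℝ)
    (hp : p ≠ 0) (hs : s ≠ 0) (hm : m ≠ 0) (hl : l ≠ 0) :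
    Tendsto (fun t : ℝ => t * ((1 + x / (p * (t * m))) * (1 + y / (s * (t * l))) - 1)) atTop
      (𝓝 (x / (p * m) + y / (s * l))) := by
  have h : Tendsto (fun t : ℝ => x / (p * m) + y / (s * l) + x * y / (p * m * s * l) * t⁻¹) atTop
      (𝓝 (x / (p * m) + y / (s * l) + x * y / (p * m * s * l) * 0)) :=
    (tendsto_inv_atTop_zero.const_mul _).const_add _
  rw [mul_zero, add_zero] at h
  refine h.congr' ?_
  filter_upwards [eventually_ne_atTop 0] with t ht
  field_simp
  ring

/-- Proposition 6.1, fourth bullet: setting `λ_j := t` simultaneously for all `j`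
(so `a_j = t μ_{lj}` and `d_j = t μ_{hj}`), the price `P_i` converges as `t → +∞` to
`(Ĝ(i) − Λ̂(i))·(Σ_j γ̃_{uj} Ω̂(j))/(r + Σ_j γ̃_{uj}(1 − Λ̂(j))) + δ_{hi}/r − q Ω̂(i)(2 − r + γ_{di}/q)`. -/
theorem stmt_12
    (K : ℕ) (hK : 1 ≤ K) (r q : ℝ) (hr : 0 < r) (hq0 : 0 < q) (hq1 : q < 1)
    (dh dd gu gd gtu gtd mul muh : Fin K → ℝ)
    (hdh : ∀ i, dd i < dh i) (hdd : ∀ i, 0 < dd i)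
    (hgu : ∀ i, 0 < gu i) (hgd : ∀ i, 0 < gd i)
    (hgtu : ∀ i, 0 < gtu i) (hgtd : ∀ i, 0 < gtd i)
    (hmul : ∀ i, 0 < mul i) (hmuh : ∀ i, 0 < muh i)
    (i : Fin K)
    (Psi : ℝ → Fin K → ℝ)
    (hPsi : ∀ t j, Psi t j =
      (1 + (gu j + gd j + r) / (q * (t * muh j))) *
        (1 + gtd j / ((1 - q) * (t * mul j))) - 1)
    (Gamma : ℝ → Fin K → ℝ)
    (hGamma : ∀ t j, Gamma t j =
      (1 + (gu j + gd j + r) / (q * (t * muh j))) *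
        (1 + (gtd j + r) / ((1 - q) * (t * mul j))) - 1)
    (Lam : ℝ → Fin K → ℝ) (hLam : ∀ t j, Lam t j = Psi t j / Gamma t j)
    (Omeg : ℝ → Fin K → ℝ)
    (hOmeg : ∀ t j, Omeg t j = dd j / (q * (t * muh j) * Gamma t j))
    (Theta : ℝ → ℝ)
    (hTheta : ∀ t, Theta t =
      (∑ j, gtu j * Omeg t j) / (r + ∑ j, gtu j * (1 - Lam t j)))
    (P : ℝ → ℝ)
    (hP : ∀ t, P t =
      (gd i / ((1 - q) * (t * mul i) * Gamma t i) - Lam t i) * Theta t + dh i / r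
        - q * Omeg t i *
          (1 + (1 - r + gd i / q) * (1 + gtd i / ((1 - q) * (t * mul i)))))
    (LamHat : Fin K → ℝ)
    (hLamHat : ∀ j, LamHat j =
      ((1 - q) * (gu j + gd j + r) * mul j + q * gtd j * muh j) /
        ((1 - q) * (gu j + gd j + r) * mul j + q * (gtd j + r) * muh j))
    (OmegHat : Fin K → ℝ)
    (hOmegHat : ∀ j, OmegHat j =
      dd j / ((gu j + gd j + r) + (q / (1 - q)) * (muh j / mul j) * (gtd j + r)))
    (GHat : ℝ)
    (hGHat : GHat = q * gd i * muh i /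
      ((1 - q) * (gu i + gd i + r) * mul i + q * (gtd i + r) * muh i)) :
    Tendsto P atTop
      (𝓝 ((GHat - LamHat i) *
            ((∑ j, gtu j * OmegHat j) / (r + ∑ j, gtu j * (1 - LamHat j)))
          + dh i / r - q * OmegHat i * (2 - r + gd i / q))) := by
  have hq : 0 < 1 - q := sub_pos.2 hq1
  have hA : ∀ j, 0 < gu j + gd j + r := fun j => by linarith [hgu j, hgd j]
  have hPsiLim : ∀ j, Tendsto (fun t => t * Psi t j) atTop
      (𝓝 ((gu j + gd j + r) / (q * muh j) + gtd j / ((1 - q) * mul j))) := fun j => by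
    simp only [hPsi]
    exact tendsto_mul_one_add_div_mul_one_add_div_sub_one _ _ hq0.ne' hq.ne'
      (hmuh j).ne' (hmul j).ne'
  have hGammaLim : ∀ j, Tendsto (fun t => t * Gamma t j) atTop
      (𝓝 ((gu j + gd j + r) / (q * muh j) + (gtd j + r) / ((1 - q) * mul j))) := fun j => by
    simp only [hGamma]
    exact tendsto_mul_one_add_div_mul_one_add_div_sub_one _ _ hq0.ne' hq.ne'
      (hmuh j).ne' (hmul j).ne'
  have hLimPos : ∀ j,
      0 < (gu j + gd j + r) / (q * muh j) + (gtd j + r) / ((1 - q) * mul j) := fun j => by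
    have := hA j; have := hgtd j; have := hmul j; have := hmuh j
    positivity
  have hLamLim : ∀ j, Tendsto (fun t => Lam t j) atTop (𝓝 (LamHat j)) := fun j => by
    have h := (hPsiLim j).div (hGammaLim j) (hLimPos j).ne'
    have := hA j; have := hgtd j; have := hmul j; have := hmuh j
    convert h.congr' ?_ using 2
    · rw [hLamHat]
      field_simp
    · filter_upwards [eventually_ne_atTop 0] with t ht
      rw [hLam, Pi.div_apply, mul_div_mul_left _ _ ht]
  have hOmegLim : ∀ j, Tendsto (fun t => Omeg t j) atTop (𝓝 (OmegHat j)) := fun j => by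
    have := hA j; have := hgtd j; have := hmul j; have := hmuh j; have := hLimPos j
    have h := (tendsto_const_nhds (x := dd j)).div ((hGammaLim j).const_mul (q * muh j))
      (by positivity)
    convert h.congr ?_ using 2
    · rw [hOmegHat]
      congr 1
      field_simp
    · intro t
      rw [hOmeg, Pi.div_apply]
      congr 1
      ring
  have hGLim : Tendsto (fun t => gd i / ((1 - q) * (t * mul i) * Gamma t i)) atTop (𝓝 GHat) := by
    have := hA i; have := hgtd i; have := hmul i; have := hmuh i; have := hLimPos i
    have h := (tendsto_const_nhds (x := gd i)).div ((hGammaLim i).const_mul ((1 - q) * mul i))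
      (by positivity)
    convert h.congr ?_ using 2
    · rw [hGHat]
      field_simp
    · intro t
      rw [Pi.div_apply]
      congr 1
      ring
  have hLamHat_le : ∀ j, LamHat j ≤ 1 := fun j => by
    have := hA j; have := hgtd j; have := hmul j; have := hmuh j
    rw [hLamHat]
    refine div_le_one_of_le₀ ?_ (by positivity)
    gcongr
    linarith
  have hden : 0 < r + ∑ j, gtu j * (1 - LamHat j) :=
    add_pos_of_pos_of_nonneg hr <| Finset.sum_nonneg fun j _ =>
      mul_nonneg (hgtu j).le (sub_nonneg.2 (hLamHat_le j))
  have hThetaLim : Tendsto Theta atTop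
      (𝓝 ((∑ j, gtu j * OmegHat j) / (r + ∑ j, gtu j * (1 - LamHat j)))) := by
    rw [funext hTheta]
    exact (tendsto_finsetSum _ fun j _ => (hOmegLim j).const_mul _).div
      ((tendsto_finsetSum _ fun j _ => ((hLamLim j).const_sub 1).const_mul _).const_add r) hden.ne'
  have hTail : Tendsto (fun t => gtd i / ((1 - q) * (t * mul i))) atTop (𝓝 0) :=
    ((tendsto_id.atTop_mul_const (hmul i)).const_mul_atTop hq).const_div_atTop _
  have h := (((hGLim.sub (hLamLim i)).mul hThetaLim).add_const (dh i / r)).sub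
    (((hOmegLim i).const_mul q).mul
      (((hTail.const_add 1).const_mul (1 - r + gd i / q)).const_add 1))
  rw [funext hP]
  convert h using 2
  ring
end

section
/- Fix an index i and hold all parameters other than λ_i fixed (including μ_{li} and μ_{hi}, so that a_i = λ_i μ_{li} and d_i = λ_i μ_{hi} vary with λ_i, and Ω(i), Λ(i), Γ(i) vary accordingly while Ω(j), Λ(j) for j ≠ i are constant). Then the function λ_i ↦ Θ is strictly increasing on (0, ∞) (the positivity of ∂Θ/∂λ_i established in the proof of Proposition 6.2). -/
open BigOperators Finset Set

theorem strictMonoOn_linear_div_affine {c b e : ℝ} (hc : 0 < c) (hb : 0 ≤ b) (he : 0 < e) :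
    StrictMonoOn (fun t : ℝ => c * t / (b * t + e)) (Ioi 0) := by
  intro s (hs : 0 < s) t (ht : 0 < t) hst
  change c * s / (b * s + e) < c * t / (b * t + e)
  rw [div_lt_div_iff₀ (by positivity) (by positivity)]
  nlinarith [mul_pos (mul_pos hc he) (sub_pos.2 hst)]

theorem antitoneOn_affine_div_affine {a c b e : ℝ} (hb : 0 < b) (he : 0 < e)
    (h : a * e ≤ c * b) :
    AntitoneOn (fun t : ℝ => (a * t + c) / (b * t + e)) (Ioi 0) := by
  intro s (hs : 0 < s) t (ht : 0 < t) hst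
  change (a * t + c) / (b * t + e) ≤ (a * s + c) / (b * s + e)
  rw [div_le_div_iff₀ (by positivity) (by positivity)]
  nlinarith [mul_nonneg (sub_nonneg.2 h) (sub_nonneg.2 hst)]

/-- The product `(1 + p / (u t)) (1 + h / (v t)) - 1` over a common denominator. -/
theorem one_add_div_mul_one_add_div_sub_one {p u v h t : ℝ} (hu : u ≠ 0) (hv : v ≠ 0)
    (ht : t ≠ 0) :
    (1 + p / (u * t)) * (1 + h / (v * t)) - 1 =
      ((p * v + h * u) * t + p * h) / (u * v * t ^ 2) := by
  field_simp
  ring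

/-- Positivity of `∂Θ/∂λ_i` (proof of Proposition 6.2): with all parameters other
than `λ_i` held fixed, the function `λ_i ↦ Θ` is strictly increasing on `(0, ∞)`. -/
theorem stmt_13
    (K : ℕ) (hK : 1 ≤ K) (r q : ℝ) (hr : 0 < r) (hq0 : 0 < q) (hq1 : q < 1)
    (dh dd gu gd gtu gtd lam mul muh : Fin K → ℝ)
    (hdh : ∀ j, dd j < dh j) (hdd : ∀ j, 0 < dd j)
    (hgu : ∀ j, 0 < gu j) (hgd : ∀ j, 0 < gd j)
    (hgtu : ∀ j, 0 < gtu j) (hgtd : ∀ j, 0 < gtd j)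
    (hlam : ∀ j, 0 < lam j) (hmul : ∀ j, 0 < mul j) (hmuh : ∀ j, 0 < muh j)
    (i : Fin K)
    (a : ℝ → Fin K → ℝ) (ha : ∀ t j, a t j = Function.update lam i t j * mul j)
    (d : ℝ → Fin K → ℝ) (hd : ∀ t j, d t j = Function.update lam i t j * muh j)
    (Psi : ℝ → Fin K → ℝ)
    (hPsi : ∀ t j, Psi t j =
      (1 + (gu j + gd j + r) / (q * d t j)) * (1 + gtd j / ((1 - q) * a t j)) - 1)
    (Gamma : ℝ → Fin K → ℝ)
    (hGamma : ∀ t j, Gamma t j =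
      (1 + (gu j + gd j + r) / (q * d t j)) *
        (1 + (gtd j + r) / ((1 - q) * a t j)) - 1)
    (Lam : ℝ → Fin K → ℝ) (hLam : ∀ t j, Lam t j = Psi t j / Gamma t j)
    (Omeg : ℝ → Fin K → ℝ)
    (hOmeg : ∀ t j, Omeg t j = dd j / (q * d t j * Gamma t j))
    (Theta : ℝ → ℝ)
    (hTheta : ∀ t, Theta t =
      (∑ j, gtu j * Omeg t j) / (r + ∑ j, gtu j * (1 - Lam t j))) :
    StrictMonoOn Theta (Ioi (0 : ℝ)) := by
  have h1q : 0 < 1 - q := sub_pos.2 hq1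
  have hOmegEq : ∀ t j, 0 < Function.update lam i t j → Omeg t j =
      dd j * ((1 - q) * mul j) * Function.update lam i t j /
        (((gu j + gd j + r) * ((1 - q) * mul j) + (gtd j + r) * (q * muh j)) *
          Function.update lam i t j + (gu j + gd j + r) * (gtd j + r)) := by
    intro t j hx
    rw [hOmeg, hGamma, ha, hd]
    generalize Function.update lam i t j = x at hx ⊢
    have := hmul j; have := hmuh j; have := hgu j; have := hgd j; have := hgtd j
    rw [show q * (x * muh j) = q * muh j * x by ring,
      show (1 - q) * (x * mul j) = (1 - q) * mul j * x by ring,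
      one_add_div_mul_one_add_div_sub_one (by positivity) (by positivity) hx.ne']
    have hN : 0 < ((gu j + gd j + r) * ((1 - q) * mul j) + (gtd j + r) * (q * muh j)) * x +
        (gu j + gd j + r) * (gtd j + r) := by positivity
    generalize ((gu j + gd j + r) * ((1 - q) * mul j) + (gtd j + r) * (q * muh j)) * x +
        (gu j + gd j + r) * (gtd j + r) = N at hN ⊢
    field_simp
  have hLamEq : ∀ t j, 0 < Function.update lam i t j → 1 - Lam t j =
      r * ((q * muh j * Function.update lam i t j + (gu j + gd j + r)) /
        (((gu j + gd j + r) * ((1 - q) * mul j) + (gtd j + r) * (q * muh j)) *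
          Function.update lam i t j + (gu j + gd j + r) * (gtd j + r))) := by
    intro t j hx
    rw [hLam, hPsi, hGamma, ha, hd]
    generalize Function.update lam i t j = x at hx ⊢
    have := hmul j; have := hmuh j; have := hgu j; have := hgd j; have := hgtd j
    rw [show q * (x * muh j) = q * muh j * x by ring,
      show (1 - q) * (x * mul j) = (1 - q) * mul j * x by ring,
      one_add_div_mul_one_add_div_sub_one (by positivity) (by positivity) hx.ne',
      one_add_div_mul_one_add_div_sub_one (by positivity) (by positivity) hx.ne',
      div_div_div_cancel_right₀ (by positivity)]
    have hN : 0 < ((gu j + gd j + r) * ((1 - q) * mul j) + (gtd j + r) * (q * muh j)) * x +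
        (gu j + gd j + r) * (gtd j + r) := by positivity
    rw [one_sub_div hN.ne', ← mul_div_assoc]
    congr 1
    ring
  have hpos : ∀ t, 0 < t → ∀ j, 0 < Function.update lam i t j := by
    intro t ht j
    rcases eq_or_ne j i with rfl | hj
    · simpa using ht
    · simpa [hj] using hlam j
  intro s (hs : 0 < s) t (ht : 0 < t) hst
  have hle : ∀ j, Function.update lam i s j ≤ Function.update lam i t j := by
    intro j
    rcases eq_or_ne j i with rfl | hj
    · simpa using hst.le
    · simp [hj]
  have hOmegMono : ∀ j, StrictMonoOn (fun x : ℝ => dd j * ((1 - q) * mul j) * x /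
      (((gu j + gd j + r) * ((1 - q) * mul j) + (gtd j + r) * (q * muh j)) * x +
        (gu j + gd j + r) * (gtd j + r))) (Ioi 0) := by
    intro j
    have := hmul j; have := hmuh j; have := hgu j; have := hgd j; have := hgtd j; have := hdd j
    exact strictMonoOn_linear_div_affine (by positivity) (by positivity) (by positivity)
  have hnum : ∑ j, gtu j * Omeg s j < ∑ j, gtu j * Omeg t j := by
    refine Finset.sum_lt_sum (fun j _ => ?_) ⟨i, Finset.mem_univ i, ?_⟩
    · refine mul_le_mul_of_nonneg_left ?_ (hgtu j).le
      rw [hOmegEq s j (hpos s hs j), hOmegEq t j (hpos t ht j)]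
      exact (hOmegMono j).monotoneOn (hpos s hs j) (hpos t ht j) (hle j)
    · refine mul_lt_mul_of_pos_left ?_ (hgtu i)
      rw [hOmegEq s i (hpos s hs i), hOmegEq t i (hpos t ht i)]
      exact hOmegMono i (hpos s hs i) (hpos t ht i) (by simpa using hst)
  have hden : r + ∑ j, gtu j * (1 - Lam t j) ≤ r + ∑ j, gtu j * (1 - Lam s j) := by
    refine add_le_add_right (Finset.sum_le_sum fun j _ => ?_) r
    refine mul_le_mul_of_nonneg_left ?_ (hgtu j).le
    rw [hLamEq s j (hpos s hs j), hLamEq t j (hpos t ht j)]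
    have := hmul j; have := hmuh j; have := hgu j; have := hgd j; have := hgtd j
    refine mul_le_mul_of_nonneg_left ?_ hr.le
    refine antitoneOn_affine_div_affine (by positivity) (by positivity) ?_
      (hpos s hs j) (hpos t ht j) (hle j)
    have : 0 < (gu j + gd j + r) * ((gu j + gd j + r) * ((1 - q) * mul j)) := by positivity
    linarith
  have hdenPos : 0 < r + ∑ j, gtu j * (1 - Lam t j) := by
    refine add_pos_of_pos_of_nonneg hr (Finset.sum_nonneg fun j _ => ?_)
    rw [hLamEq t j (hpos t ht j)]
    have := hpos t ht j
    have := hmul j; have := hmuh j; have := hgu j; have := hgd j; have := hgtd j; have := hgtu j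
    positivity
  have hnumNonneg : 0 ≤ ∑ j, gtu j * Omeg t j := by
    refine Finset.sum_nonneg fun j _ => ?_
    rw [hOmegEq t j (hpos t ht j)]
    have := hpos t ht j
    have := hmul j; have := hmuh j; have := hgu j; have := hgd j; have := hgtd j; have := hgtu j
    have := hdd j
    positivity
  rw [hTheta, hTheta]
  exact div_lt_div₀ hnum hden hnumNonneg hdenPos
end

section
/- Fix distinct indices i ≠ j and regard P_j as a function of λ_i (all other parameters, including λ_j, μ_{li}, μ_{hi}, held fixed; only Θ depends on λ_i). If D_j := (γ_{dj} − γ̃_{dj}) q μ_{hj} − (γ_j + r)(1−q) μ_{lj} ≤ 0, then the coefficient A_j := γ_{dj}/((1−q) a_j Γ(j)) − Λ(j) is strictly negative and the function λ_i ↦ P_j(λ_i) is strictly decreasing on (0, ∞) (Proposition 6.2, degenerate case established in its proof). -/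
open BigOperators Finset Set

/-- Clearing denominators in `Γ`, with `x = q d`, `y = (1 - q) a`, `s = γ + r`, `h = γ̃ + r`. -/
lemma shifted_product_eq {x y s h : ℝ} (hx : 0 < x) (hy : 0 < y) :
    (1 + s / x) * (1 + h / y) - 1 = (s * y + h * x + s * h) / (x * y) := by
  field_simp
  ring

lemma omega_eq {x y s h e : ℝ} (hx : 0 < x) (hy : 0 < y) (hs : 0 < s) (hh : 0 < h) :
    e / (x * ((1 + s / x) * (1 + h / y) - 1)) = e * y / (s * y + h * x + s * h) := by
  have : 0 < s * y + h * x + s * h := by positivity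
  rw [shifted_product_eq hx hy]
  field_simp

lemma one_sub_lambda_eq {x y s g r : ℝ} (hx : 0 < x) (hy : 0 < y) (hs : 0 < s)
    (hg : 0 < g) (hr : 0 < r) :
    1 - ((1 + s / x) * (1 + g / y) - 1) / ((1 + s / x) * (1 + (g + r) / y) - 1)
      = r * (x + s) / (s * y + (g + r) * x + s * (g + r)) := by
  have : 0 < s * y + (g + r) * x + s * (g + r) := by positivity
  rw [shifted_product_eq hx hy, shifted_product_eq hx hy]
  field_simp
  ring

/-- `Ω` is strictly increasing in the meeting intensity. -/
lemma omega_lt_omega {m n s h e t u : ℝ} (hm : 0 < m) (hn : 0 < n) (hs : 0 < s) (hh : 0 < h)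
    (he : 0 < e) (ht : 0 < t) (htu : t < u) :
    e * (n * t) / (s * (n * t) + h * (m * t) + s * h)
      < e * (n * u) / (s * (n * u) + h * (m * u) + s * h) := by
  have hu : 0 < u := ht.trans htu
  rw [div_lt_div_iff₀ (by positivity) (by positivity), ← sub_pos]
  have hpos : 0 < e * n * s * h * (u - t) := mul_pos (by positivity) (sub_pos.2 htu)
  linear_combination hpos

/-- `1 - Λ` is strictly decreasing in the meeting intensity. -/
lemma one_sub_lambda_lt {m n s h r t u : ℝ} (hm : 0 < m) (hn : 0 < n) (hs : 0 < s) (hh : 0 < h)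
    (hr : 0 < r) (ht : 0 < t) (htu : t < u) :
    r * (m * u + s) / (s * (n * u) + h * (m * u) + s * h)
      < r * (m * t + s) / (s * (n * t) + h * (m * t) + s * h) := by
  have hu : 0 < u := ht.trans htu
  rw [div_lt_div_iff₀ (by positivity) (by positivity), ← sub_pos]
  have hpos : 0 < r * s ^ 2 * n * (u - t) := mul_pos (by positivity) (sub_pos.2 htu)
  linear_combination hpos

/-- Proposition 6.2, degenerate case (from its proof): if
`D_j = (γ_{dj} − γ̃_{dj}) q μ_{hj} − (γ_j + r)(1−q) μ_{lj} ≤ 0`, then the coefficient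
`A_j = γ_{dj}/((1−q) a_j Γ(j)) − Λ(j)` is strictly negative and `λ_i ↦ P_j(λ_i)` is
strictly decreasing on `(0, ∞)`. -/
theorem stmt_14
    (K : ℕ) (hK : 2 ≤ K) (r q : ℝ) (hr : 0 < r) (hq0 : 0 < q) (hq1 : q < 1)
    (dh dd gu gd gtu gtd lam mul muh : Fin K → ℝ)
    (hdh : ∀ k, dd k < dh k) (hdd : ∀ k, 0 < dd k)
    (hgu : ∀ k, 0 < gu k) (hgd : ∀ k, 0 < gd k)
    (hgtu : ∀ k, 0 < gtu k) (hgtd : ∀ k, 0 < gtd k)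
    (hlam : ∀ k, 0 < lam k) (hmul : ∀ k, 0 < mul k) (hmuh : ∀ k, 0 < muh k)
    (i j : Fin K) (hij : i ≠ j)
    -- varying quantities, as functions of `t = λ_i` (all other parameters fixed)
    (a : ℝ → Fin K → ℝ) (ha : ∀ t k, a t k = Function.update lam i t k * mul k)
    (d : ℝ → Fin K → ℝ) (hd : ∀ t k, d t k = Function.update lam i t k * muh k)
    (Psi : ℝ → Fin K → ℝ)
    (hPsi : ∀ t k, Psi t k =
      (1 + (gu k + gd k + r) / (q * d t k)) * (1 + gtd k / ((1 - q) * a t k)) - 1)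
    (Gamma : ℝ → Fin K → ℝ)
    (hGamma : ∀ t k, Gamma t k =
      (1 + (gu k + gd k + r) / (q * d t k)) *
        (1 + (gtd k + r) / ((1 - q) * a t k)) - 1)
    (Lam : ℝ → Fin K → ℝ) (hLam : ∀ t k, Lam t k = Psi t k / Gamma t k)
    (Omeg : ℝ → Fin K → ℝ)
    (hOmeg : ∀ t k, Omeg t k = dd k / (q * d t k * Gamma t k))
    (Theta : ℝ → ℝ)
    (hTheta : ∀ t, Theta t =
      (∑ k, gtu k * Omeg t k) / (r + ∑ k, gtu k * (1 - Lam t k)))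
    (A : ℝ)
    (hA : A = gd j / ((1 - q) * (lam j * mul j) * Gamma (lam i) j) - Lam (lam i) j)
    (P : ℝ → ℝ)
    (hP : ∀ t, P t = A * Theta t + dh j / r
      - q * Omeg t j *
        (1 + (1 - r + gd j / q) * (1 + gtd j / ((1 - q) * (lam j * mul j)))))
    (hD : (gd j - gtd j) * q * muh j - (gu j + gd j + r) * (1 - q) * mul j ≤ 0) :
    A < 0 ∧ StrictAntiOn P (Ioi (0 : ℝ)) := by
  have hq' : 0 < 1 - q := sub_pos.2 hq1
  have hs : ∀ k, 0 < gu k + gd k + r := fun k => by linarith [hgu k, hgd k]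
  have hh : ∀ k, 0 < gtd k + r := fun k => by linarith [hgtd k]
  have hm : ∀ k, 0 < q * muh k := fun k => mul_pos hq0 (hmuh k)
  have hn : ∀ k, 0 < (1 - q) * mul k := fun k => mul_pos hq' (hmul k)
  have hupd : ∀ t, 0 < t → ∀ k, 0 < Function.update lam i t k := by
    intro t ht k
    rcases eq_or_ne k i with rfl | hk
    · simpa using ht
    · simpa [hk] using hlam k
  have hx : ∀ t k, q * d t k = q * muh k * Function.update lam i t k := fun t k => by
    rw [hd]; ring
  have hy : ∀ t k, (1 - q) * a t k = (1 - q) * mul k * Function.update lam i t k := fun t k => by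
    rw [ha]; ring
  have hO : ∀ t, 0 < t → ∀ k, Omeg t k =
      dd k * ((1 - q) * mul k * Function.update lam i t k) /
        ((gu k + gd k + r) * ((1 - q) * mul k * Function.update lam i t k)
          + (gtd k + r) * (q * muh k * Function.update lam i t k)
          + (gu k + gd k + r) * (gtd k + r)) := fun t ht k => by
    rw [hOmeg, hGamma, hx, hy]
    exact omega_eq (mul_pos (hm k) (hupd t ht k)) (mul_pos (hn k) (hupd t ht k)) (hs k) (hh k)
  have hL : ∀ t, 0 < t → ∀ k, 1 - Lam t k =
      r * (q * muh k * Function.update lam i t k + (gu k + gd k + r)) /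
        ((gu k + gd k + r) * ((1 - q) * mul k * Function.update lam i t k)
          + (gtd k + r) * (q * muh k * Function.update lam i t k)
          + (gu k + gd k + r) * (gtd k + r)) := fun t ht k => by
    rw [hLam, hPsi, hGamma, hx, hy]
    exact one_sub_lambda_eq (mul_pos (hm k) (hupd t ht k)) (mul_pos (hn k) (hupd t ht k))
      (hs k) (hgtd k) hr
  have hOpos : ∀ t, 0 < t → ∀ k, 0 < Omeg t k := fun t ht k => by
    rw [hO t ht k]
    have := hupd t ht k
    have := hm k; have := hn k; have := hs k; have := hh k; have := hdd k
    positivity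
  have hLpos : ∀ t, 0 < t → ∀ k, 0 < 1 - Lam t k := fun t ht k => by
    rw [hL t ht k]
    have := hupd t ht k
    have := hm k; have := hn k; have := hs k; have := hh k
    positivity
  have hOlt : ∀ t u, 0 < t → t < u → Omeg t i < Omeg u i := fun t u ht htu => by
    rw [hO t ht, hO u (ht.trans htu)]
    simpa only [Function.update_self] using
      omega_lt_omega (hm i) (hn i) (hs i) (hh i) (hdd i) ht htu
  have hLlt : ∀ t u, 0 < t → t < u → 1 - Lam u i < 1 - Lam t i := fun t u ht htu => by
    rw [hL t ht, hL u (ht.trans htu)]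
    simpa only [Function.update_self] using
      one_sub_lambda_lt (hm i) (hn i) (hs i) (hh i) hr ht htu
  have hOne : ∀ t u, 0 < t → 0 < u → ∀ k, k ≠ i → Omeg t k = Omeg u k :=
    fun t u ht hu k hk => by
      rw [hO t ht, hO u hu, Function.update_of_ne hk, Function.update_of_ne hk]
  have hLne : ∀ t u, 0 < t → 0 < u → ∀ k, k ≠ i → 1 - Lam u k = 1 - Lam t k :=
    fun t u ht hu k hk => by
      rw [hL t ht, hL u hu, Function.update_of_ne hk, Function.update_of_ne hk]
  have hThetalt : ∀ t u, 0 < t → t < u → Theta t < Theta u := by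
    intro t u ht htu
    have hu : 0 < u := ht.trans htu
    have hnum : ∑ k, gtu k * Omeg t k < ∑ k, gtu k * Omeg u k := by
      refine Finset.sum_lt_sum (fun k _ => ?_)
        ⟨i, Finset.mem_univ i, mul_lt_mul_of_pos_left (hOlt t u ht htu) (hgtu i)⟩
      rcases eq_or_ne k i with rfl | hk
      · exact (mul_lt_mul_of_pos_left (hOlt t u ht htu) (hgtu k)).le
      · rw [hOne t u ht hu k hk]
    have hden : ∑ k, gtu k * (1 - Lam u k) ≤ ∑ k, gtu k * (1 - Lam t k) := by
      refine Finset.sum_le_sum fun k _ => ?_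
      rcases eq_or_ne k i with rfl | hk
      · exact (mul_lt_mul_of_pos_left (hLlt t u ht htu) (hgtu k)).le
      · rw [hLne t u ht hu k hk]
    have hnonneg : 0 ≤ ∑ k, gtu k * Omeg u k :=
      Finset.sum_nonneg fun k _ => (mul_pos (hgtu k) (hOpos u hu k)).le
    have hden_nonneg : 0 ≤ ∑ k, gtu k * (1 - Lam u k) :=
      Finset.sum_nonneg fun k _ => (mul_pos (hgtu k) (hLpos u hu k)).le
    rw [hTheta, hTheta]
    exact div_lt_div₀ hnum (by linarith) hnonneg (by linarith)
  have hA0 : A < 0 := by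
    have hlj := hlam j
    have hmj := hm j
    have hnj := hn j
    have hsj := hs j
    have hhj := hh j
    have hgj := hgtd j
    have hX : 0 < q * muh j * lam j := mul_pos hmj hlj
    have hY : 0 < (1 - q) * mul j * lam j := mul_pos hnj hlj
    have hG : 0 < Gamma (lam i) j := by
      rw [hGamma, hx, hy, Function.update_of_ne hij.symm, shifted_product_eq hX hY]
      positivity
    have hPs : Psi (lam i) j = ((gu j + gd j + r) * ((1 - q) * mul j * lam j)
        + gtd j * (q * muh j * lam j) + (gu j + gd j + r) * gtd j)
        / (q * muh j * lam j * ((1 - q) * mul j * lam j)) := by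
      rw [hPsi, hx, hy, Function.update_of_ne hij.symm, shifted_product_eq hX hY]
    have hlt : gd j / ((1 - q) * mul j * lam j) < Psi (lam i) j := by
      rw [hPs, div_lt_div_iff₀ hY (mul_pos hX hY), ← mul_assoc]
      refine mul_lt_mul_of_pos_right ?_ hY
      have hDl := mul_nonpos_of_nonpos_of_nonneg hD hlj.le
      have := mul_pos hsj hgj
      linear_combination hDl + this
    rw [hA, hLam, show (1 - q) * (lam j * mul j) = (1 - q) * mul j * lam j by ring,
      ← div_div, ← sub_div]
    exact div_neg_of_neg_of_pos (sub_neg.2 hlt) hG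
  refine ⟨hA0, fun t ht u _ htu => ?_⟩
  have ht : 0 < t := ht
  rw [hP, hP, hOne t u ht (ht.trans htu) j hij.symm]
  have := mul_lt_mul_of_neg_left (hThetalt t u ht htu) hA0
  linarith
end

section
/- (Hawkins–Simon) Let A be an n×n real matrix with nonpositive off-diagonal entries (a_{ij} ≤ 0 for all i ≠ j). Then the following are equivalent: (i) there exists a vector x ∈ ℝ^n with all components strictly positive such that all components of Ax are strictly positive; (ii) for every p = 1,…,n, the leading principal minor det((a_{ij})_{1≤i,j≤p}) is strictly positive. -/
open BigOperators Finset Matrix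

/-- The Schur complement of the top left entry of a matrix. -/
noncomputable def schurHead {n : ℕ} (A : Matrix (Fin (n + 1)) (Fin (n + 1)) ℝ) :
    Matrix (Fin n) (Fin n) ℝ :=
  Matrix.of fun i j => A i.succ j.succ - A i.succ 0 / A 0 0 * A 0 j.succ

theorem det_eq_head_mul_det_schurHead {n : ℕ} (A : Matrix (Fin (n + 1)) (Fin (n + 1)) ℝ)
    (h : A 0 0 ≠ 0) : A.det = A 0 0 * (schurHead A).det := by
  let c : Fin (n + 1) → ℝ := Fin.cons 0 fun i => -(A i.succ 0 / A 0 0)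
  let B : Matrix (Fin (n + 1)) (Fin (n + 1)) ℝ := Matrix.of fun i j => A i j + c i * A 0 j
  have hB : B.det = A.det :=
    Matrix.det_eq_of_forall_row_eq_smul_add_const c 0 rfl fun _ _ => rfl
  have hS : B.submatrix Fin.succ Fin.succ = schurHead A := by
    ext i j
    simp [B, c, schurHead]
    ring
  have hcol : ∀ i : Fin n, B i.succ 0 = 0 := by
    intro i
    simp [B, c, h]
  have h00 : B 0 0 = A 0 0 := by simp [B, c]
  rw [← hB, Matrix.det_succ_column_zero, Fin.sum_univ_succ]
  simp [hcol, h00, Fin.succAbove_zero, hS]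

theorem schurHead_offDiag_nonpos {n : ℕ} {A : Matrix (Fin (n + 1)) (Fin (n + 1)) ℝ}
    (hoff : ∀ i j, i ≠ j → A i j ≤ 0) (h : 0 < A 0 0) (i j : Fin n) (hij : i ≠ j) :
    schurHead A i j ≤ 0 := by
  have h1 := hoff i.succ j.succ (by simpa using hij)
  have h2 := hoff i.succ 0 (Fin.succ_ne_zero i)
  have h3 := hoff 0 j.succ (Fin.succ_ne_zero j).symm
  have h4 := mul_nonneg_of_nonpos_of_nonpos (div_nonpos_of_nonpos_of_nonneg h2 h.le) h3
  simp only [schurHead, Matrix.of_apply]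
  linarith

theorem mulVec_succ_eq_schurHead_mulVec_add {n : ℕ} (A : Matrix (Fin (n + 1)) (Fin (n + 1)) ℝ)
    (h : A 0 0 ≠ 0) (x : Fin (n + 1) → ℝ) (i : Fin n) :
    A.mulVec x i.succ =
      (schurHead A).mulVec (fun j => x j.succ) i + A i.succ 0 / A 0 0 * A.mulVec x 0 := by
  simp only [Matrix.mulVec, dotProduct, Fin.sum_univ_succ, schurHead, Matrix.of_apply, sub_mul,
    Finset.sum_sub_distrib, mul_add, Finset.mul_sum]
  have : A i.succ 0 / A 0 0 * (A 0 0 * x 0) = A i.succ 0 * x 0 := by field_simp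
  simp only [this, mul_assoc]
  ring

theorem leadingMinors_pos_iff_schurHead {n : ℕ} (A : Matrix (Fin (n + 1)) (Fin (n + 1)) ℝ) :
    (∀ p : Fin (n + 1),
        0 < Matrix.det (A.submatrix (Fin.castLE p.isLt) (Fin.castLE p.isLt))) ↔
      0 < A 0 0 ∧ ∀ p : Fin n,
        0 < Matrix.det ((schurHead A).submatrix (Fin.castLE p.isLt) (Fin.castLE p.isLt)) := by
  have hzero : Matrix.det (A.submatrix (Fin.castLE (0 : Fin (n + 1)).isLt)
      (Fin.castLE (0 : Fin (n + 1)).isLt)) = A 0 0 :=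
    Matrix.det_fin_one _
  have hsucc (h : A 0 0 ≠ 0) (p : Fin n) : Matrix.det (A.submatrix (Fin.castLE p.succ.isLt)
      (Fin.castLE p.succ.isLt)) = A 0 0 *
        Matrix.det ((schurHead A).submatrix (Fin.castLE p.isLt) (Fin.castLE p.isLt)) :=
    det_eq_head_mul_det_schurHead (n := p + 1)
      (A.submatrix (Fin.castLE p.succ.isLt) (Fin.castLE p.succ.isLt)) h
  rw [Fin.forall_fin_succ, hzero]
  refine and_congr_right fun h => forall_congr' fun p => ?_
  rw [hsucc h.ne' p, mul_pos_iff_of_pos_left h]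

theorem exists_pos_mulVec_pos_iff_schurHead {n : ℕ}
    {A : Matrix (Fin (n + 1)) (Fin (n + 1)) ℝ} (hoff : ∀ i j, i ≠ j → A i j ≤ 0) :
    (∃ x : Fin (n + 1) → ℝ, (∀ i, 0 < x i) ∧ ∀ i, 0 < A.mulVec x i) ↔
      0 < A 0 0 ∧ ∃ y : Fin n → ℝ, (∀ i, 0 < y i) ∧ ∀ i, 0 < (schurHead A).mulVec y i := by
  have hrow (x : Fin (n + 1) → ℝ) (hx : ∀ j : Fin n, 0 < x j.succ) :
      ∑ j : Fin n, A 0 j.succ * x j.succ ≤ 0 :=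
    Finset.sum_nonpos fun j _ =>
      mul_nonpos_of_nonpos_of_nonneg (hoff 0 j.succ (Fin.succ_ne_zero j).symm) (hx j).le
  have hhead (x : Fin (n + 1) → ℝ) :
      A.mulVec x 0 = A 0 0 * x 0 + ∑ j : Fin n, A 0 j.succ * x j.succ := by
    simp [Matrix.mulVec, dotProduct, Fin.sum_univ_succ]
  constructor
  · rintro ⟨x, hx, hAx⟩
    have h : 0 < A 0 0 := by
      have h0 := hAx 0
      rw [hhead] at h0
      have := hrow x fun j => hx j.succ
      exact (mul_pos_iff_of_pos_right (hx 0)).mp (by linarith)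
    refine ⟨h, fun j => x j.succ, fun j => hx j.succ, fun i => ?_⟩
    have h1 := hAx i.succ
    rw [mulVec_succ_eq_schurHead_mulVec_add A h.ne'] at h1
    have h2 := mul_nonpos_of_nonpos_of_nonneg
      (div_nonpos_of_nonpos_of_nonneg (hoff i.succ 0 (Fin.succ_ne_zero i)) h.le) (hAx 0).le
    linarith
  · rintro ⟨h, y, hy, hSy⟩
    obtain ⟨ε, hε, hεS⟩ : ∃ ε : ℝ, 0 < ε ∧
        ∀ i : Fin n, 0 < (schurHead A).mulVec y i + A i.succ 0 / A 0 0 * ε := by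
      have hev : ∀ᶠ ε in nhdsWithin (0 : ℝ) (Set.Ioi 0),
          ∀ i : Fin n, 0 < (schurHead A).mulVec y i + A i.succ 0 / A 0 0 * ε := by
        refine Filter.eventually_all.mpr fun i => ?_
        have hc : Continuous fun ε : ℝ =>
            (schurHead A).mulVec y i + A i.succ 0 / A 0 0 * ε := by fun_prop
        exact nhdsWithin_le_nhds (hc.continuousAt.eventually_const_lt (by simpa using hSy i))
      obtain ⟨ε, hεS, hε⟩ := (hev.and self_mem_nhdsWithin).exists
      exact ⟨ε, hε, hεS⟩
    let x : Fin (n + 1) → ℝ := Fin.cons ((ε - ∑ j : Fin n, A 0 j.succ * y j) / A 0 0) y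
    have hx0 : A.mulVec x 0 = ε := by
      rw [hhead]
      simp only [x, Fin.cons_zero, Fin.cons_succ]
      field_simp
      ring
    refine ⟨x, ?_, ?_⟩
    · refine Fin.cases ?_ hy
      have := hrow x hy
      exact div_pos (by simp only [x, Fin.cons_succ] at this; linarith) h
    · refine Fin.cases (by rwa [hx0]) fun i => ?_
      rw [mulVec_succ_eq_schurHead_mulVec_add A h.ne', hx0]
      exact hεS i

/-- Hawkins–Simon: for a real square matrix with nonpositive off-diagonal entries,
the existence of a positive vector `x` with `Ax > 0` componentwise is equivalent to
all leading principal minors being strictly positive. -/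
theorem stmt_18
    (n : ℕ) (A : Matrix (Fin n) (Fin n) ℝ)
    (hoff : ∀ i j, i ≠ j → A i j ≤ 0) :
    (∃ x : Fin n → ℝ, (∀ i, 0 < x i) ∧ ∀ i, 0 < A.mulVec x i) ↔
      (∀ p : Fin n,
        0 < Matrix.det (A.submatrix (Fin.castLE p.isLt) (Fin.castLE p.isLt))) := by
  induction n with
  | zero => exact ⟨fun _ p => p.elim0, fun _ => ⟨0, fun i => i.elim0, fun i => i.elim0⟩⟩
  | succ n ih =>
    rw [exists_pos_mulVec_pos_iff_schurHead hoff, leadingMinors_pos_iff_schurHead]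
    exact and_congr_right fun h => ih _ (schurHead_offDiag_nonpos hoff h)
end
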